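/- arXiv:1203.3709 — 12 statements merged into one kernel-verified Lean document; each statement's English description precedes it below -/
import Mathlib

section
/- Let U be a subset of ℝ^q, and for each y ∈ U let B(y) be a real q×p matrix. For y ∈ U define the p-dimensional affine subspace F_y = {(ξ, B(y)ξ + y) : ξ ∈ ℝ^p} of ℝ^p × ℝ^q, and let A(y) denote the q×(p+1) matrix obtained from B(y) by adjoining the column y. Then the subspaces F_y, y ∈ U, are pairwise skew if and only if for every pair of distinct points y₁, y₂ ∈ U the matrix A(y₁) − A(y₂) has trivial kernel. -/
/-- The set of differences of elements of `S` (for an affine subspace, this is its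
direction subspace as a set). -/
def dirSet {V : Type*} [AddCommGroup V] (S : Set V) : Set V :=
  {v | ∃ a ∈ S, ∃ b ∈ S, v = a - b}

/-- Two (affine) subsets are skew if they are disjoint and their direction sets
intersect only in the zero vector. -/
def SkewSets {V : Type*} [AddCommGroup V] (S T : Set V) : Prop :=
  S ∩ T = ∅ ∧ ∀ v, v ∈ dirSet S → v ∈ dirSet T → v = 0

/-- The `q × (p+1)` matrix `[B | y]` obtained from a `q × p` matrix `B` by adjoining
the column `y`. -/
def appendCol {p q : ℕ} (B : Matrix (Fin q) (Fin p) ℝ) (y : Fin q → ℝ) :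
    Matrix (Fin q) (Fin (p + 1)) ℝ :=
  Matrix.of fun i => Fin.snoc (B i) (y i)

lemma appendCol_sub_mulVec_snoc {p q : ℕ} (B₁ B₂ : Matrix (Fin q) (Fin p) ℝ)
    (y₁ y₂ : Fin q → ℝ) (ξ : Fin p → ℝ) (t : ℝ) :
    (appendCol B₁ y₁ - appendCol B₂ y₂).mulVec (Fin.snoc ξ t : Fin (p + 1) → ℝ) =
      (B₁.mulVec ξ - B₂.mulVec ξ) + t • (y₁ - y₂) := by
  rw [Matrix.sub_mulVec]
  ext i
  simp [appendCol, Matrix.mulVec, dotProduct, Fin.sum_univ_castSucc]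
  ring

theorem skew_iff_aux {p q : ℕ} (B₁ B₂ : Matrix (Fin q) (Fin p) ℝ) (y₁ y₂ : Fin q → ℝ) :
    SkewSets {z : (Fin p → ℝ) × (Fin q → ℝ) | ∃ ξ : Fin p → ℝ, z = (ξ, B₁.mulVec ξ + y₁)}
      {z | ∃ ξ : Fin p → ℝ, z = (ξ, B₂.mulVec ξ + y₂)} ↔
    ∀ v : Fin (p + 1) → ℝ,
      (appendCol B₁ y₁ - appendCol B₂ y₂).mulVec v = 0 → v = 0 := by
  constructor
  · rintro ⟨hd, hs⟩ v hv
    obtain ⟨ξ, t, rfl⟩ : ∃ (ξ : Fin p → ℝ) (t : ℝ), v = (Fin.snoc ξ t : Fin (p + 1) → ℝ) :=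
      ⟨Fin.init v, v (Fin.last p), (Fin.snoc_init_self v).symm⟩
    rw [appendCol_sub_mulVec_snoc] at hv
    by_cases ht : t = 0
    · subst ht
      have h : B₁.mulVec ξ = B₂.mulVec ξ := by
        rw [zero_smul, add_zero] at hv
        exact sub_eq_zero.mp hv
      have h0 := hs (ξ, B₁.mulVec ξ)
        ⟨_, ⟨ξ, rfl⟩, _, ⟨0, rfl⟩, by simp⟩
        ⟨_, ⟨ξ, rfl⟩, _, ⟨0, rfl⟩, by simp [h]⟩
      have hξ : ξ = 0 := congrArg Prod.fst h0
      subst hξ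
      ext i
      refine Fin.lastCases ?_ (fun j => ?_) i <;> simp
    · exfalso
      have hmem : (t⁻¹ • ξ, B₁.mulVec (t⁻¹ • ξ) + y₁) ∈ (∅ : Set ((Fin p → ℝ) × (Fin q → ℝ))) := by
        rw [← hd]
        refine ⟨⟨_, rfl⟩, ⟨t⁻¹ • ξ, ?_⟩⟩
        congr 1
        have h2 : t⁻¹ • ((B₁.mulVec ξ - B₂.mulVec ξ) + t • (y₁ - y₂)) = 0 := by
          rw [hv, smul_zero]
        rw [smul_add, smul_smul, inv_mul_cancel₀ ht, one_smul, smul_sub] at h2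
        rw [Matrix.mulVec_smul, Matrix.mulVec_smul, ← sub_eq_zero, ← h2]
        abel
      exact hmem
  · intro h
    constructor
    · ext z
      simp only [Set.mem_inter_iff, Set.mem_setOf_eq, Set.mem_empty_iff_false, iff_false]
      rintro ⟨⟨ξ, rfl⟩, ⟨η, hη⟩⟩
      obtain ⟨rfl, h2⟩ := Prod.mk.inj hη
      have h3 := h (Fin.snoc ξ 1) (by
        rw [appendCol_sub_mulVec_snoc, one_smul, ← sub_eq_zero.mpr h2]
        abel)
      have h4 := congrFun h3 (Fin.last p)
      simp at h4
    · rintro v ⟨_, ⟨a, rfl⟩, _, ⟨b, rfl⟩, rfl⟩ ⟨_, ⟨c, rfl⟩, _, ⟨d, rfl⟩, hv⟩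
      obtain ⟨h1, h2⟩ := Prod.mk.inj hv
      have h3 := h (Fin.snoc (a - b) 0) (by
        rw [appendCol_sub_mulVec_snoc, zero_smul, add_zero, sub_eq_zero]
        have h1' : a - b = c - d := h1
        conv_rhs => rw [h1']
        rw [Matrix.mulVec_sub, Matrix.mulVec_sub]
        simpa using h2)
      have hab : a = b := by
        ext j
        have h4 := congrFun h3 j.castSucc
        simp at h4
        linarith
      subst hab
      simp

theorem stmt0 (p q : ℕ) (U : Set (Fin q → ℝ))
    (B : (Fin q → ℝ) → Matrix (Fin q) (Fin p) ℝ)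
    (F : (Fin q → ℝ) → Set ((Fin p → ℝ) × (Fin q → ℝ)))
    (hF : ∀ y, F y = {z | ∃ ξ : Fin p → ℝ, z = (ξ, (B y).mulVec ξ + y)}) :
    (∀ y₁ ∈ U, ∀ y₂ ∈ U, y₁ ≠ y₂ → SkewSets (F y₁) (F y₂)) ↔
    (∀ y₁ ∈ U, ∀ y₂ ∈ U, y₁ ≠ y₂ →
      ∀ v : Fin (p + 1) → ℝ,
        (appendCol (B y₁) y₁ - appendCol (B y₂) y₂).mulVec v = 0 → v = 0) := by
  simp only [hF, skew_iff_aux]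
end

section
/- Let A₁, …, A_{p+1} be real q×q matrices satisfying the Hurwitz equations. For y ∈ ℝ^q define F_y = {(ξ, (ξ₁A₁ + ⋯ + ξ_pA_p + A_{p+1})y) : ξ ∈ ℝ^p} ⊆ ℝ^p × ℝ^q. Then each F_y is a p-dimensional affine subspace of ℝ^{p+q}, the subspaces F_y for distinct y ∈ ℝ^q are pairwise skew, and the union of all F_y, y ∈ ℝ^q, equals ℝ^{p+q}. -/
open Matrix

/-- Real `q × q` matrices `A₁, …, A_r` satisfy the Hurwitz equations if `Aᵢᵀ Aᵢ = 1`
for all `i` and `Aᵢᵀ Aⱼ + Aⱼᵀ Aᵢ = 0` for `i ≠ j`. -/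
def HurwitzEqs {q r : ℕ} (A : Fin r → Matrix (Fin q) (Fin q) ℝ) : Prop :=
  (∀ i, (A i)ᵀ * A i = 1) ∧ ∀ i j, i ≠ j → (A i)ᵀ * A j + (A j)ᵀ * A i = 0

theorem hurwitz_aux {q r : ℕ} (A : Fin r → Matrix (Fin q) (Fin q) ℝ) (hA : HurwitzEqs A)
    (c : Fin r → ℝ) :
    (∑ i, c i • A i)ᵀ * (∑ i, c i • A i) = (∑ i, c i ^ 2) • (1 : Matrix (Fin q) (Fin q) ℝ) := by
  have h1 : (∑ i, c i • A i)ᵀ * (∑ i, c i • A i)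
      = ∑ i, ∑ j, (c i * c j) • ((A i)ᵀ * A j) := by
    rw [Matrix.transpose_sum, Finset.sum_mul_sum]
    refine Finset.sum_congr rfl fun i _ => Finset.sum_congr rfl fun j _ => ?_
    rw [Matrix.transpose_smul, Matrix.smul_mul, Matrix.mul_smul, smul_smul]
  have h2 : ∑ i, ∑ j, (c i * c j) • ((A i)ᵀ * A j)
      = ∑ i, ∑ j, (c i * c j) • ((A j)ᵀ * A i) := by
    rw [Finset.sum_comm]
    refine Finset.sum_congr rfl fun i _ => Finset.sum_congr rfl fun j _ => ?_
    rw [mul_comm]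
  have h3 : ∑ i, ∑ j, (c i * c j) • ((A i)ᵀ * A j) + ∑ i, ∑ j, (c i * c j) • ((A j)ᵀ * A i)
      = (2 : ℝ) • (∑ i, c i ^ 2) • (1 : Matrix (Fin q) (Fin q) ℝ) := by
    rw [← Finset.sum_add_distrib, Finset.sum_smul, Finset.smul_sum]
    refine Finset.sum_congr rfl fun i _ => ?_
    rw [← Finset.sum_add_distrib, Finset.sum_eq_single i]
    · rw [hA.1 i, two_smul, pow_two]
    · intro j _ hj
      rw [← smul_add, hA.2 i j hj.symm, smul_zero]
    · simp
  rw [← h2, ← two_smul ℝ] at h3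
  rw [h1]
  exact smul_right_injective _ (two_ne_zero (α := ℝ)) h3

theorem hurwitz_inj {q r : ℕ} (A : Fin r → Matrix (Fin q) (Fin q) ℝ) (hA : HurwitzEqs A)
    (c : Fin r → ℝ) (y : Fin q → ℝ) (h : (∑ i, c i • A i).mulVec y = 0) (hy : y ≠ 0) : c = 0 := by
  have h1 := congrArg (fun M => M.mulVec y) (hurwitz_aux A hA c)
  simp only [← Matrix.mulVec_mulVec, h, Matrix.mulVec_zero, Matrix.smul_mulVec,
    Matrix.one_mulVec] at h1
  have h2 : ∑ i, c i ^ 2 = 0 := (smul_eq_zero.mp h1.symm).resolve_right hy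
  rw [Finset.sum_eq_zero_iff_of_nonneg (fun i _ => sq_nonneg _)] at h2
  funext i
  simpa using h2 i (Finset.mem_univ i)

theorem sum_snoc_aux {q p : ℕ} (A : Fin (p + 1) → Matrix (Fin q) (Fin q) ℝ)
    (ξ : Fin p → ℝ) (t : ℝ) :
    ∑ i, (Fin.snoc ξ t : Fin (p + 1) → ℝ) i • A i
      = (∑ i : Fin p, ξ i • A i.castSucc) + t • A (Fin.last p) := by
  rw [Fin.sum_univ_castSucc]
  simp

theorem inj_one {q p : ℕ} (A : Fin (p + 1) → Matrix (Fin q) (Fin q) ℝ) (hA : HurwitzEqs A)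
    (ξ : Fin p → ℝ) (y : Fin q → ℝ)
    (h : ((∑ i : Fin p, ξ i • A i.castSucc) + A (Fin.last p)).mulVec y = 0) : y = 0 := by
  by_contra hy
  have h0 := hurwitz_inj A hA (Fin.snoc ξ 1) y (by rw [sum_snoc_aux, one_smul]; exact h) hy
  have := congrFun h0 (Fin.last p)
  simp at this

theorem inj_two {q p : ℕ} (A : Fin (p + 1) → Matrix (Fin q) (Fin q) ℝ) (hA : HurwitzEqs A)
    (ξ : Fin p → ℝ) (y : Fin q → ℝ) (hy : y ≠ 0)
    (h : (∑ i : Fin p, ξ i • A i.castSucc).mulVec y = 0) : ξ = 0 := by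
  have h0 := hurwitz_inj A hA (Fin.snoc ξ 0) y
    (by rw [sum_snoc_aux, zero_smul, add_zero]; exact h) hy
  funext i
  have := congrFun h0 i.castSucc
  simpa using this

/-- The linear part of the parametrization of `F_y`. -/
def linPart {q p : ℕ} (A : Fin (p + 1) → Matrix (Fin q) (Fin q) ℝ) (y : Fin q → ℝ) :
    (Fin p → ℝ) →ₗ[ℝ] (Fin p → ℝ) × (Fin q → ℝ) where
  toFun ξ := (ξ, (∑ i : Fin p, ξ i • A i.castSucc).mulVec y)
  map_add' a b := by
    simp [add_smul, Finset.sum_add_distrib, Matrix.add_mulVec]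
  map_smul' t a := by
    simp [mul_smul, ← Finset.smul_sum, Matrix.smul_mulVec]

theorem stmt1 (p q : ℕ) (A : Fin (p + 1) → Matrix (Fin q) (Fin q) ℝ)
    (hA : HurwitzEqs A)
    (F : (Fin q → ℝ) → Set ((Fin p → ℝ) × (Fin q → ℝ)))
    (hF : ∀ y, F y = {z | ∃ ξ : Fin p → ℝ,
      z = (ξ, ((∑ i : Fin p, ξ i • A i.castSucc) + A (Fin.last p)).mulVec y)}) :
    (∀ y : Fin q → ℝ, ∃ S : AffineSubspace ℝ ((Fin p → ℝ) × (Fin q → ℝ)),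
      (S : Set ((Fin p → ℝ) × (Fin q → ℝ))) = F y ∧ Module.finrank ℝ S.direction = p) ∧
    (∀ y₁ y₂ : Fin q → ℝ, y₁ ≠ y₂ → SkewSets (F y₁) (F y₂)) ∧
    (⋃ y : Fin q → ℝ, F y) = Set.univ := by
  refine ⟨fun y => ?_, fun y₁ y₂ hy => ⟨?_, ?_⟩, ?_⟩
  · refine ⟨AffineSubspace.mk' (0, (A (Fin.last p)).mulVec y) (LinearMap.range (linPart A y)),
      ?_, ?_⟩
    · rw [hF]
      ext ⟨a, b⟩
      simp only [SetLike.mem_coe, AffineSubspace.mem_mk', LinearMap.mem_range, Set.mem_setOf_eq,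
        linPart, LinearMap.coe_mk, AddHom.coe_mk, vsub_eq_sub, Prod.mk_sub_mk, Prod.mk.injEq,
        sub_zero, Matrix.add_mulVec, eq_sub_iff_add_eq]
      exact exists_congr fun ξ => and_congr eq_comm eq_comm
    · rw [AffineSubspace.direction_mk', LinearMap.finrank_range_of_inj]
      · simp
      · intro a b h
        exact congrArg Prod.fst h
  · rw [hF, hF, Set.eq_empty_iff_forall_notMem]
    rintro z ⟨⟨ξ, h1⟩, ⟨η, h2⟩⟩
    rw [h1, Prod.mk.injEq] at h2
    obtain ⟨rfl, h2⟩ := h2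
    apply hy
    rw [← sub_eq_zero]
    exact inj_one A hA ξ _ (by rw [Matrix.mulVec_sub, h2, sub_self])
  · have key : ∀ y v, v ∈ dirSet (F y) →
        v.2 = (∑ i : Fin p, v.1 i • A i.castSucc).mulVec y := by
      rintro y v ⟨a, ha, b, hb, rfl⟩
      rw [hF] at ha hb
      obtain ⟨ξ, rfl⟩ := ha
      obtain ⟨η, rfl⟩ := hb
      simp [sub_smul, Finset.sum_sub_distrib, Matrix.sub_mulVec, Matrix.add_mulVec]
    intro v h1 h2
    have e1 := key _ _ h1
    have e2 := key _ _ h2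
    have h0 : v.1 = 0 := inj_two A hA v.1 (y₁ - y₂) (sub_ne_zero.mpr hy)
      (by rw [Matrix.mulVec_sub, ← e1, ← e2, sub_self])
    refine Prod.ext h0 ?_
    rw [e1, h0]
    simp
  · refine Set.eq_univ_of_forall ?_
    rintro ⟨ξ, w⟩
    have hinj : Function.Injective
        (Matrix.mulVecLin ((∑ i : Fin p, ξ i • A i.castSucc) + A (Fin.last p))) := by
      rw [injective_iff_map_eq_zero]
      intro y h
      exact inj_one A hA ξ y h
    obtain ⟨y, hy⟩ := LinearMap.surjective_of_injective hinj w
    rw [Set.mem_iUnion]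
    refine ⟨y, ?_⟩
    rw [hF]
    exact ⟨ξ, by rw [← hy]; rfl⟩
end

section
/- Let p, q ≥ 1 with p ≤ ρ(q) − 1 and set n = p + q. Then there exists a family of pairwise skew p-dimensional affine subspaces of ℝ^n whose union is all of ℝ^n. -/
/-- The Hurwitz-Radon function: writing `q = 2^k * (2*m+1)`,
`ρ(q) = 2k+1` if `k ≡ 0 [MOD 4]`, `2k` if `k ≡ 1, 2 [MOD 4]`, `2k+2` if `k ≡ 3 [MOD 4]`. -/
def hurwitzRadon (q : ℕ) : ℕ :=
  let k := q.factorization 2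
  if k % 4 = 0 then 2 * k + 1
  else if k % 4 = 3 then 2 * k + 2
  else 2 * k

/-- Two affine subspaces are skew if they are disjoint and their direction
(linear) subspaces intersect only in the zero vector. -/
def SkewAff {n : ℕ} (S T : AffineSubspace ℝ (Fin n → ℝ)) : Prop :=
  (S : Set (Fin n → ℝ)) ∩ (T : Set (Fin n → ℝ)) = ∅ ∧ S.direction ⊓ T.direction = ⊥

open scoped Kronecker

/-- `ι`-indexed anticommuting family of real matrices squaring to `-1`. -/
def HRFam {ι κ : Type} [Fintype κ] [DecidableEq κ] (A : ι → Matrix κ κ ℝ) : Prop :=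
  (∀ i, A i * A i = -1) ∧ ∀ i j, i ≠ j → A i * A j = -(A j * A i)

def HR (ι κ : Type) [Fintype κ] [DecidableEq κ] : Prop :=
  ∃ A : ι → Matrix κ κ ℝ, HRFam A

def mS : Matrix (Fin 2) (Fin 2) ℝ := !![0, 1; 1, 0]
def mT : Matrix (Fin 2) (Fin 2) ℝ := !![1, 0; 0, -1]
def mE : Matrix (Fin 2) (Fin 2) ℝ := !![0, 1; -1, 0]

lemma mSS : mS * mS = 1 := by
  ext i j; fin_cases i <;> fin_cases j <;> simp [mS]
lemma mTT : mT * mT = 1 := by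
  ext i j; fin_cases i <;> fin_cases j <;> simp [mT]
lemma mEE : mE * mE = -1 := by
  ext i j; fin_cases i <;> fin_cases j <;> simp [mE]
lemma mTS : mT * mS = - (mS * mT) := by
  ext i j; fin_cases i <;> fin_cases j <;> simp [mS, mT]
lemma mES : mE * mS = - (mS * mE) := by
  ext i j; fin_cases i <;> fin_cases j <;> simp [mS, mE]
lemma mET : mE * mT = - (mT * mE) := by
  ext i j; fin_cases i <;> fin_cases j <;> simp [mT, mE]

lemma neg_kron {κ l : Type} (A : Matrix κ κ ℝ) (B : Matrix l l ℝ) :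
    (-A) ⊗ₖ B = -(A ⊗ₖ B) := by
  ext i j; simp [Matrix.kroneckerMap_apply]
lemma kron_neg {κ l : Type} (A : Matrix κ κ ℝ) (B : Matrix l l ℝ) :
    A ⊗ₖ (-B) = -(A ⊗ₖ B) := by
  ext i j; simp [Matrix.kroneckerMap_apply]

lemma HR.reindex {ι ι' κ κ' : Type} [Fintype κ] [DecidableEq κ] [Fintype κ'] [DecidableEq κ']
    (h : HR ι κ) (f : ι' ↪ ι) (e : κ ≃ κ') : HR ι' κ' := by
  obtain ⟨A, h1, h2⟩ := h
  refine ⟨fun i => Matrix.reindexAlgEquiv ℝ ℝ e (A (f i)), fun i => ?_, fun i j hij => ?_⟩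
  · simp only [← map_mul, h1, map_neg, map_one]
  · simp only [← map_mul, ← map_neg]
    rw [h2 _ _ (f.injective.ne hij)]

lemma HR.combine {ι ι' κ : Type} [Fintype κ] [DecidableEq κ]
    {A : ι → Matrix κ κ ℝ} {B : ι' → Matrix κ κ ℝ} (hA : HRFam A) (hB : HRFam B)
    (hAB : ∀ i j, A i * B j = B j * A i) : HR (ι ⊕ ι' ⊕ Unit) (κ × Fin 2) := by
  refine ⟨Sum.elim (fun i => A i ⊗ₖ mS) (Sum.elim (fun i => B i ⊗ₖ mT)
    (fun _ => (1 : Matrix κ κ ℝ) ⊗ₖ mE)), ?_, ?_⟩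
  · rintro (i | i | i)
    · simp [← Matrix.mul_kronecker_mul, hA.1, mSS, neg_kron]
    · simp [← Matrix.mul_kronecker_mul, hB.1, mTT, neg_kron]
    · simp [← Matrix.mul_kronecker_mul, mEE, kron_neg]
  · rintro (i | i | i) (j | j | j) hij
    · have : i ≠ j := by rintro rfl; exact hij rfl
      simp [← Matrix.mul_kronecker_mul, hA.2 i j this, neg_kron]
    · simp [← Matrix.mul_kronecker_mul, hAB, mTS, kron_neg]
    · simp [← Matrix.mul_kronecker_mul, mES, kron_neg]
    · simp [← Matrix.mul_kronecker_mul, hAB, mTS, kron_neg]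
    · have : i ≠ j := by rintro rfl; exact hij rfl
      simp [← Matrix.mul_kronecker_mul, hB.2 i j this, neg_kron]
    · simp [← Matrix.mul_kronecker_mul, mET, kron_neg]
    · simp [← Matrix.mul_kronecker_mul, mES, kron_neg]
    · simp [← Matrix.mul_kronecker_mul, mET, kron_neg]
    · exact absurd rfl hij

lemma HR.congr {m d : ℕ} {ι κ : Type} [Fintype ι] [Fintype κ] [DecidableEq κ]
    (h : HR ι κ) (h1 : m ≤ Fintype.card ι) (h2 : Fintype.card κ = d) : HR (Fin m) (Fin d) := by
  have : Nonempty (Fin m ↪ ι) := by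
    rw [Function.Embedding.nonempty_iff_card_le]; simpa using h1
  exact h.reindex this.some (Fintype.equivFinOfCardEq h2)

lemma HR1 : HR (Fin 0) (Fin 1) := ⟨fun _ => 1, fun i => i.elim0, fun i => i.elim0⟩

lemma famE : HRFam (fun _ : Unit => mE) :=
  ⟨fun _ => mEE, fun i j h => absurd rfl h⟩

lemma HR2 : HR (Fin 1) (Fin 2) :=
  HR.congr ⟨_, famE⟩ (by simp) (by simp)

lemma HR4 : HR (Fin 3) (Fin 4) :=
  HR.congr (HR.combine famE famE (fun _ _ => rfl)) (by simp) (by simp)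

def qL : Fin 3 → Matrix (Fin 2 × Fin 2) (Fin 2 × Fin 2) ℝ := ![mE ⊗ₖ 1, mS ⊗ₖ mE, mT ⊗ₖ mE]
def qR : Fin 3 → Matrix (Fin 2 × Fin 2) (Fin 2 × Fin 2) ℝ := ![1 ⊗ₖ mE, mE ⊗ₖ mS, mE ⊗ₖ mT]

lemma famL : HRFam qL := by
  constructor
  · intro i
    fin_cases i <;>
      simp [qL, ← Matrix.mul_kronecker_mul, mSS, mTT, mEE, neg_kron, kron_neg]
  · intro i j h
    fin_cases i <;> fin_cases j <;> first | exact absurd rfl h |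
      simp [qL, ← Matrix.mul_kronecker_mul, mTS, mES, mET, mEE, neg_kron, kron_neg]

lemma famR : HRFam qR := by
  constructor
  · intro i
    fin_cases i <;>
      simp [qR, ← Matrix.mul_kronecker_mul, mSS, mTT, mEE, neg_kron, kron_neg]
  · intro i j h
    fin_cases i <;> fin_cases j <;> first | exact absurd rfl h |
      simp [qR, ← Matrix.mul_kronecker_mul, mTS, mES, mET, mEE, neg_kron, kron_neg]

lemma HR8 : HR (Fin 7) (Fin 8) := by
  refine HR.congr (HR.combine famL famR ?_) (by simp) (by simp)
  intro i j
  fin_cases i <;> fin_cases j <;>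
    simp [qL, qR, ← Matrix.mul_kronecker_mul, mTS, mES, mET, mEE, neg_kron, kron_neg]

lemma HR.kron_left {ι κ l : Type} [Fintype κ] [DecidableEq κ] [Fintype l] [DecidableEq l]
    {A : ι → Matrix κ κ ℝ} (hA : HRFam A) :
    HRFam (fun i => A i ⊗ₖ (1 : Matrix l l ℝ)) := by
  refine ⟨fun i => ?_, fun i j h => ?_⟩
  · simp [← Matrix.mul_kronecker_mul, hA.1, neg_kron]
  · simp [← Matrix.mul_kronecker_mul, hA.2 i j h, neg_kron]

lemma HR.kron_right {ι κ l : Type} [Fintype κ] [DecidableEq κ] [Fintype l] [DecidableEq l]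
    {A : ι → Matrix κ κ ℝ} (hA : HRFam A) :
    HRFam (fun i => (1 : Matrix l l ℝ) ⊗ₖ A i) := by
  refine ⟨fun i => ?_, fun i j h => ?_⟩
  · simp [← Matrix.mul_kronecker_mul, hA.1, kron_neg]
  · simp [← Matrix.mul_kronecker_mul, hA.2 i j h, kron_neg]

lemma HR.step {m d : ℕ} (h : HR (Fin m) (Fin d)) : HR (Fin (m + 8)) (Fin (d * 16)) := by
  obtain ⟨A, hA⟩ := h
  obtain ⟨C, hC⟩ := HR8
  refine HR.congr (HR.combine (HR.kron_left (l := Fin 8) hA)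
    (HR.kron_right (l := Fin d) hC) ?_) (by simp) (by simp; ring)
  intro i j
  simp [← Matrix.mul_kronecker_mul]

lemma HR.iter {m d : ℕ} (h : HR (Fin m) (Fin d)) (a : ℕ) :
    HR (Fin (m + 8 * a)) (Fin (d * 16 ^ a)) := by
  induction a with
  | zero => exact h.congr (by simp) (by simp)
  | succ a ih =>
    have := ih.step
    rwa [mul_assoc, ← pow_succ, add_assoc, show 8 * a + 8 = 8 * (a + 1) by ring] at this

lemma HR.exists (p q : ℕ) (hq : 1 ≤ q) (hpq : p ≤ hurwitzRadon q - 1) : HR (Fin p) (Fin q) := by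
  set k := q.factorization 2 with hk
  have hdvd : 2 ^ k ∣ q := Nat.ordProj_dvd q 2
  obtain ⟨c, hc⟩ := hdvd
  have key : ∃ m d, HR (Fin m) (Fin d) ∧ p ≤ m ∧ d = 2 ^ k := by
    have h16 : (16 : ℕ) ^ (k / 4) = 2 ^ (4 * (k / 4)) := by rw [pow_mul]; norm_num
    have hkk := Nat.div_add_mod k 4
    unfold hurwitzRadon at hpq
    simp only [← hk] at hpq
    have h4 : k % 4 < 4 := Nat.mod_lt _ (by norm_num)
    obtain h | h | h | h : k % 4 = 0 ∨ k % 4 = 1 ∨ k % 4 = 2 ∨ k % 4 = 3 := by omega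
    · refine ⟨_, _, HR1.iter (k / 4), ?_, ?_⟩
      · simp [h] at hpq; omega
      · rw [h16]; conv_rhs => rw [← hkk, h]
        ring
    · refine ⟨_, _, HR2.iter (k / 4), ?_, ?_⟩
      · simp [h] at hpq; omega
      · rw [h16]; conv_rhs => rw [← hkk, h]
        ring
    · refine ⟨_, _, HR4.iter (k / 4), ?_, ?_⟩
      · simp [h] at hpq; omega
      · rw [h16]; conv_rhs => rw [← hkk, h]
        ring
    · refine ⟨_, _, HR8.iter (k / 4), ?_, ?_⟩
      · simp [h] at hpq; omega
      · rw [h16]; conv_rhs => rw [← hkk, h]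
        ring
  obtain ⟨m, d, ⟨A, hA⟩, hpm, rfl⟩ := key
  exact HR.congr ⟨_, HR.kron_left (l := Fin c) hA⟩ (by simpa using hpm)
    (by simp [← hc])

/-- The linear combination, as a bilinear map. -/
noncomputable def hrM {p q : ℕ} (A : Fin p → Matrix (Fin q) (Fin q) ℝ) (t : Fin p → ℝ) :
    Matrix (Fin q) (Fin q) ℝ := ∑ i, t i • A i

lemma hrM_sq {p q : ℕ} {A : Fin p → Matrix (Fin q) (Fin q) ℝ} (hA : HRFam A) (t : Fin p → ℝ) :
    hrM A t * hrM A t = -((∑ i, t i ^ 2) • (1 : Matrix (Fin q) (Fin q) ℝ)) := by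
  have e1 : hrM A t * hrM A t = ∑ i, ∑ j, (t i * t j) • (A i * A j) := by
    simp only [hrM, Finset.sum_mul_sum, smul_mul_smul_comm]
  have e2 : hrM A t * hrM A t = ∑ i, ∑ j, (t i * t j) • (A j * A i) := by
    rw [e1, Finset.sum_comm]
    simp only [mul_comm (t _) (t _)]
  have e3 : hrM A t * hrM A t + hrM A t * hrM A t =
      ∑ i, ∑ j, if i = j then (-2 * t i ^ 2) • (1 : Matrix (Fin q) (Fin q) ℝ) else 0 := by
    conv_lhs => rw [e1]
    conv_lhs => arg 2; rw [← e1, e2]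
    simp only [← Finset.sum_add_distrib]
    refine Finset.sum_congr rfl fun i _ => Finset.sum_congr rfl fun j _ => ?_
    split_ifs with h
    · subst h
      rw [hA.1]; module
    · rw [hA.2 i j h]; simp
  simp only [Finset.sum_ite_eq, Finset.mem_univ, if_true, ← Finset.sum_smul, ← Finset.mul_sum] at e3
  have : (2 : ℝ) • (hrM A t * hrM A t) =
      (2 : ℝ) • -((∑ i, t i ^ 2) • (1 : Matrix (Fin q) (Fin q) ℝ)) := by
    rw [two_smul, e3]; module
  exact smul_right_injective _ (two_ne_zero) this

theorem stmt2 (p q n : ℕ) (hp : 1 ≤ p) (hq : 1 ≤ q)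
    (hpq : p ≤ hurwitzRadon q - 1) (hn : n = p + q) :
    ∃ F : Set (AffineSubspace ℝ (Fin n → ℝ)),
      (∀ S ∈ F, Module.finrank ℝ S.direction = p) ∧
      (∀ S ∈ F, ∀ T ∈ F, S ≠ T → SkewAff S T) ∧
      (∀ x : Fin n → ℝ, ∃ S ∈ F, x ∈ S) := by
  obtain ⟨A, hA⟩ := HR.exists p q hq hpq
  have hadd : ∀ s t, hrM A (s + t) = hrM A s + hrM A t := by
    intro s t; simp [hrM, add_smul, Finset.sum_add_distrib]
  have hsmul : ∀ (c : ℝ) t, hrM A (c • t) = c • hrM A t := by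
    intro s t; simp [hrM, mul_smul, Finset.smul_sum]
  let e : ((Fin p → ℝ) × (Fin q → ℝ)) ≃ₗ[ℝ] (Fin n → ℝ) :=
    LinearEquiv.ofFinrankEq _ _ (by simp [hn])
  let g : (Fin q → ℝ) → (Fin p → ℝ) →ₗ[ℝ] (Fin p → ℝ) × (Fin q → ℝ) := fun x =>
    { toFun := fun t => (t, (hrM A t).mulVec x)
      map_add' := fun s t => by simp [hadd, Matrix.add_mulVec]
      map_smul' := fun c t => by simp [hsmul, Matrix.smul_mulVec] }
  let φ : (Fin q → ℝ) → (Fin p → ℝ) →ₗ[ℝ] (Fin n → ℝ) := fun x => e.toLinearMap ∘ₗ g x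
  have hφ : ∀ x t, φ x t = e (t, (hrM A t).mulVec x) := fun _ _ => rfl
  let S : (Fin q → ℝ) → AffineSubspace ℝ (Fin n → ℝ) := fun x =>
    AffineSubspace.mk' (e (0, x)) (LinearMap.range (φ x))
  have hmem : ∀ x y, y ∈ S x ↔ ∃ t, y = e (t, x + (hrM A t).mulVec x) := by
    intro x y
    simp only [S, AffineSubspace.mem_mk', LinearMap.mem_range, hφ, vsub_eq_sub, eq_sub_iff_add_eq,
      ← map_add, Prod.mk_add_mk, add_zero]
    simp only [eq_comm, add_comm]
  have hdir : ∀ x, (S x).direction = LinearMap.range (φ x) := fun x =>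
    AffineSubspace.direction_mk' _ _
  have hsum : ∀ t : Fin p → ℝ, 0 ≤ ∑ i, t i ^ 2 := fun t => Finset.sum_nonneg fun i _ => sq_nonneg _
  have hinj : ∀ t z, z + (hrM A t).mulVec z = 0 → z = 0 := by
    intro t z h
    have h2 := congrArg (fun v => v - (hrM A t).mulVec v) h
    simp only [Matrix.mulVec_add, Matrix.mulVec_mulVec, hrM_sq hA, Matrix.neg_mulVec,
      Matrix.smul_mulVec, Matrix.one_mulVec, Matrix.mulVec_zero, sub_zero] at h2
    have h3 : (1 + ∑ i, t i ^ 2) • z = 0 := by rw [← h2]; module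
    exact (smul_eq_zero.1 h3).resolve_left (by linarith [hsum t] |> fun (h : 0 < 1 + ∑ i, t i ^ 2) => h.ne')
  refine ⟨Set.range S, ?_, ?_, ?_⟩
  · rintro _ ⟨x, rfl⟩
    rw [hdir, LinearMap.finrank_range_of_inj]
    · simp
    · intro s t h
      rw [hφ, hφ] at h
      exact (Prod.ext_iff.1 (e.injective h)).1
  · rintro _ ⟨x, rfl⟩ _ ⟨y, rfl⟩ hxy
    have hne : x - y ≠ 0 := fun h => hxy (by rw [sub_eq_zero.1 h])
    constructor
    · rw [Set.eq_empty_iff_forall_notMem]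
      rintro v ⟨h1, h2⟩
      obtain ⟨t, rfl⟩ := (hmem _ _).1 h1
      obtain ⟨s, hs⟩ := (hmem _ _).1 h2
      have := Prod.ext_iff.1 (e.injective hs)
      obtain ⟨h3, h4⟩ := this
      simp only at h3 h4
      subst h3
      apply hne
      apply hinj t
      rw [Matrix.mulVec_sub, sub_add_sub_comm, h4, sub_self]
    · rw [hdir, hdir, Submodule.eq_bot_iff]
      rintro v ⟨⟨t, rfl⟩, ⟨s, hs⟩⟩
      rw [hφ, hφ] at hs
      obtain ⟨h3, h4⟩ := Prod.ext_iff.1 (e.injective hs)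
      simp only at h3 h4
      subst h3
      have h5 : (hrM A s).mulVec (x - y) = 0 := by rw [Matrix.mulVec_sub, h4, sub_self]
      have h6 := congrArg (fun v => (hrM A s).mulVec v) h5
      simp only [Matrix.mulVec_mulVec, hrM_sq hA, Matrix.neg_mulVec,
        Matrix.smul_mulVec, Matrix.one_mulVec, Matrix.mulVec_zero, neg_eq_zero] at h6
      have h7 := (smul_eq_zero.1 h6).resolve_right hne
      have h8 : s = 0 := by
        funext i
        have := (Finset.sum_eq_zero_iff_of_nonneg (fun i _ => sq_nonneg (s i))).1 h7 i
          (Finset.mem_univ i)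
        simpa using this
      rw [h8, map_zero]
  · intro v
    obtain ⟨⟨t, w⟩, rfl⟩ := e.surjective v
    have hpos : (1 + ∑ i, t i ^ 2) ≠ 0 := by have := hsum t; positivity
    refine ⟨_, ⟨(1 + ∑ i, t i ^ 2)⁻¹ • (w - (hrM A t).mulVec w), rfl⟩, (hmem _ _).2 ⟨t, ?_⟩⟩
    congr 2
    rw [Matrix.mulVec_smul, ← smul_add, eq_inv_smul_iff₀ hpos]
    simp only [Matrix.mulVec_sub, Matrix.mulVec_mulVec, hrM_sq hA, Matrix.neg_mulVec,
      Matrix.smul_mulVec, Matrix.one_mulVec]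
    module
end

section
/- Let U ⊆ ℝ^q with 0 ∈ U, let B : U → Mat_{q×p}(ℝ) satisfy B(0) = 0, and suppose that for every pair of distinct points y₁, y₂ ∈ U the q×(p+1) matrix obtained from B(y₁) − B(y₂) by adjoining the column y₁ − y₂ has trivial kernel. Then for every nonzero y ∈ U, the orthogonal projections of the p columns of B(y) onto the hyperplane orthogonal to y are linearly independent vectors in ℝ^q. -/
open Matrix

theorem stmt4 (p q : ℕ) (U : Set (Fin q → ℝ)) (h0 : (0 : Fin q → ℝ) ∈ U)
    (B : (Fin q → ℝ) → Matrix (Fin q) (Fin p) ℝ) (hB0 : B 0 = 0)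
    (hker : ∀ y₁ ∈ U, ∀ y₂ ∈ U, y₁ ≠ y₂ →
      ∀ v : Fin (p + 1) → ℝ,
        (appendCol (B y₁ - B y₂) (y₁ - y₂)).mulVec v = 0 → v = 0) :
    ∀ y ∈ U, y ≠ 0 →
      LinearIndependent ℝ (fun j : Fin p =>
        (fun i => B y i j) - (((fun i => B y i j) ⬝ᵥ y) / (y ⬝ᵥ y)) • y) := by
  intro y hy hy0
  rw [Fintype.linearIndependent_iff]
  intro g hg j
  have key := hker y hy 0 h0 hy0
    (Fin.snoc g (-∑ j, g j * (((fun i => B y i j) ⬝ᵥ y) / (y ⬝ᵥ y))) : Fin (p + 1) → ℝ) ?_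
  · have := congrFun key j.castSucc
    simpa using this
  · funext i
    have hi := congrFun hg i
    simp only [Finset.sum_apply, Pi.smul_apply, Pi.sub_apply, smul_eq_mul, Pi.zero_apply,
      mul_sub, Finset.sum_sub_distrib] at hi
    simp only [appendCol, Matrix.mulVec, dotProduct, Matrix.of_apply, Fin.sum_univ_castSucc,
      Fin.snoc_castSucc, Fin.snoc_last, hB0, sub_zero, Pi.zero_apply] at hi ⊢
    rw [← hi, mul_neg, ← sub_eq_add_neg, Finset.mul_sum]
    congr 1
    · exact Finset.sum_congr rfl fun _ _ => mul_comm _ _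
    · exact Finset.sum_congr rfl fun _ _ => by ring
end

section
/- Let A₁, …, A_r be real q×q matrices satisfying the Hurwitz equations, with r ≥ 1. Then for each j with 1 ≤ j ≤ r−1 the matrix A_r^{-1}A_j is skew-symmetric, and for every nonzero vector v ∈ ℝ^q the vectors A_r^{-1}A₁v, …, A_r^{-1}A_{r−1}v are each orthogonal to v and, together with v, form a linearly independent family of r vectors in ℝ^q. -/
open Matrix

theorem hurwitz_dot {q r : ℕ} (A : Fin r → Matrix (Fin q) (Fin q) ℝ)
    (hA : HurwitzEqs A) (v : Fin q → ℝ) (i j : Fin r) :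
    (A i *ᵥ v) ⬝ᵥ (A j *ᵥ v) = if i = j then v ⬝ᵥ v else 0 := by
  have key : ∀ i j : Fin r, (A i *ᵥ v) ⬝ᵥ (A j *ᵥ v) = v ⬝ᵥ (((A i)ᵀ * A j) *ᵥ v) := by
    intro i j
    rw [← Matrix.mulVec_mulVec, Matrix.dotProduct_mulVec v, Matrix.vecMul_transpose]
  split_ifs with h
  · subst h
    rw [key, hA.1, Matrix.one_mulVec]
  · have h1 := congrArg (fun M => v ⬝ᵥ (M *ᵥ v)) (hA.2 i j h)
    simp only [Matrix.add_mulVec, dotProduct_add, Matrix.zero_mulVec, dotProduct_zero] at h1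
    rw [← key, ← key, dotProduct_comm (A j *ᵥ v)] at h1
    linarith

theorem stmt6 (q r : ℕ) (hr : 1 ≤ r) (A : Fin r → Matrix (Fin q) (Fin q) ℝ)
    (hA : HurwitzEqs A) :
    (∀ j : Fin r, (j : ℕ) < r - 1 →
      ((A ⟨r - 1, by omega⟩)⁻¹ * A j)ᵀ = -((A ⟨r - 1, by omega⟩)⁻¹ * A j)) ∧
    ∀ v : Fin q → ℝ, v ≠ 0 →
      (∀ j : Fin r, (j : ℕ) < r - 1 →
        ((A ⟨r - 1, by omega⟩)⁻¹ * A j).mulVec v ⬝ᵥ v = 0) ∧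
      LinearIndependent ℝ (fun i : Fin r =>
        if (i : ℕ) < r - 1 then ((A ⟨r - 1, by omega⟩)⁻¹ * A i).mulVec v else v) := by
  have hl : r - 1 < r := by omega
  generalize hL : A ⟨r - 1, _⟩ = L
  have hLL : Lᵀ * L = 1 := by rw [← hL]; exact hA.1 _
  have hLL' : L * Lᵀ = 1 := mul_eq_one_comm.mp hLL
  have hinv : L⁻¹ = Lᵀ := Matrix.inv_eq_left_inv hLL
  rw [hinv]
  have hne : ∀ j : Fin r, (j : ℕ) < r - 1 → j ≠ ⟨r - 1, hl⟩ := by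
    rintro j hj rfl
    simp at hj
  refine ⟨?_, ?_⟩
  · intro j hj
    have h := hA.2 j _ (hne j hj)
    rw [hL] at h
    rw [Matrix.transpose_mul, Matrix.transpose_transpose]
    exact eq_neg_of_add_eq_zero_left h
  · intro v hv
    have hvv : v ⬝ᵥ v ≠ 0 := fun h => hv (dotProduct_self_eq_zero.mp h)
    refine ⟨?_, ?_⟩
    · intro j hj
      have h := hurwitz_dot A hA v j ⟨r - 1, hl⟩
      rw [if_neg (hne j hj), hL] at h
      rw [← Matrix.mulVec_mulVec, dotProduct_comm, Matrix.dotProduct_mulVec,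
        Matrix.vecMul_transpose, dotProduct_comm]
      exact h
    · have hfam : (fun i : Fin r => if (i : ℕ) < r - 1 then (Lᵀ * A i).mulVec v else v)
          = fun i => Lᵀ *ᵥ (A i *ᵥ v) := by
        funext i
        split_ifs with h
        · rw [Matrix.mulVec_mulVec]
        · have hi : i = ⟨r - 1, hl⟩ := Fin.ext (by have := i.2; simp only; omega)
          rw [hi, hL, Matrix.mulVec_mulVec, hLL, Matrix.one_mulVec]
      rw [hfam, Fintype.linearIndependent_iff]
      intro c hc j
      have h1 := congrArg (fun w => (A j *ᵥ v) ⬝ᵥ (L *ᵥ w)) hc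
      simp only [Matrix.mulVec_sum, Matrix.mulVec_smul, Matrix.mulVec_mulVec, ← Matrix.mul_assoc,
        hLL', Matrix.one_mul, Matrix.mulVec_zero, dotProduct_zero, dotProduct_sum,
        dotProduct_smul, hurwitz_dot A hA, smul_eq_mul, mul_ite, mul_zero,
        Finset.sum_ite_eq, Finset.mem_univ, if_true] at h1
      exact (mul_eq_zero.mp h1).resolve_right hvv
end

section
/- Let A₁, …, A_r be real q×q matrices and for a ∈ ℝ^r, b ∈ ℝ^q define c(a,b) = (a₁A₁ + ⋯ + a_rA_r)b ∈ ℝ^q. Then the identity (a₁² + ⋯ + a_r²)(b₁² + ⋯ + b_q²) = ‖c(a,b)‖² holds for all a ∈ ℝ^r and b ∈ ℝ^q if and only if the matrices A₁, …, A_r satisfy the Hurwitz equations. -/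
open Matrix

lemma symm_zero_aux {q : ℕ} (S : Matrix (Fin q) (Fin q) ℝ) (hS : Sᵀ = S)
    (h : ∀ b : Fin q → ℝ, b ⬝ᵥ (S *ᵥ b) = 0) : S = 0 := by
  have hd : ∀ i, S i i = 0 := by
    intro i
    simpa using h (Pi.single i 1)
  ext i j
  have h1 := h (Pi.single i 1 + Pi.single j 1)
  have h2 : S j i = S i j := congrFun (congrFun hS i) j
  simp [Matrix.mulVec_add, dotProduct_add, add_dotProduct, hd, h2] at h1
  simpa using h1

lemma sum_sq_aux {q : ℕ} (M : Matrix (Fin q) (Fin q) ℝ) (b : Fin q → ℝ) :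
    ∑ j, (M.mulVec b j) ^ 2 = b ⬝ᵥ ((Mᵀ * M) *ᵥ b) := by
  rw [← Matrix.mulVec_mulVec, Matrix.dotProduct_mulVec, Matrix.vecMul_transpose]
  simp [dotProduct, sq]

lemma sq_iff_aux {q : ℕ} (M : Matrix (Fin q) (Fin q) ℝ) (c : ℝ) :
    (∀ b : Fin q → ℝ, c * (∑ j, (b j) ^ 2) = ∑ j, (M.mulVec b j) ^ 2) ↔
      Mᵀ * M = c • (1 : Matrix (Fin q) (Fin q) ℝ) := by
  have e : ∀ b : Fin q → ℝ, ∑ j, (b j) ^ 2 = b ⬝ᵥ b := by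
    intro b
    simp [dotProduct, sq]
  constructor
  · intro h
    rw [← sub_eq_zero]
    apply symm_zero_aux
    · simp [Matrix.transpose_sub, Matrix.transpose_mul]
    · intro b
      have := h b
      rw [sum_sq_aux, e] at this
      rw [Matrix.sub_mulVec, dotProduct_sub, ← this, Matrix.smul_mulVec, Matrix.one_mulVec,
        dotProduct_smul, smul_eq_mul, sub_self]
  · intro h b
    rw [sum_sq_aux, e, h, Matrix.smul_mulVec, Matrix.one_mulVec, dotProduct_smul, smul_eq_mul]

theorem stmt7 (q r : ℕ) (A : Fin r → Matrix (Fin q) (Fin q) ℝ) :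
    (∀ (a : Fin r → ℝ) (b : Fin q → ℝ),
      (∑ i, (a i) ^ 2) * (∑ j, (b j) ^ 2) = ∑ j, ((∑ i, a i • A i).mulVec b j) ^ 2) ↔
    HurwitzEqs A := by
  have key : ∀ a : Fin r → ℝ, _ := fun a => sq_iff_aux (∑ i, a i • A i) (∑ i, (a i) ^ 2)
  rw [forall_congr' key]
  constructor
  · intro h
    have h1 : ∀ i, (A i)ᵀ * A i = 1 := by
      intro i
      simpa [Pi.single_apply] using h (Pi.single i 1)
    refine ⟨h1, fun i j hij => ?_⟩
    have h2 := h (Pi.single i 1 + Pi.single j 1)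
    have h3 : ∑ k, ((Pi.single i 1 + Pi.single j 1 : Fin r → ℝ) k) ^ 2 = 2 := by
      simp only [Pi.add_apply, add_sq, Finset.sum_add_distrib]
      simp [Pi.single_apply, hij.symm, hij]
      norm_num
    have h4 : ∑ k, ((Pi.single i 1 + Pi.single j 1 : Fin r → ℝ) k) • A k = A i + A j := by
      simp [add_smul, Finset.sum_add_distrib, Pi.single_apply]
    rw [h3, h4, Matrix.transpose_add, add_mul, mul_add, mul_add, h1, h1, two_smul] at h2
    have h5 : (A i)ᵀ * A j + (A j)ᵀ * A i =
      (1 + (A i)ᵀ * A j + ((A j)ᵀ * A i + 1)) - (1 + 1) := by abel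
    rw [h5, h2, sub_self]
  · rintro ⟨h1, h2⟩ a
    have e : (∑ i, a i • A i)ᵀ * (∑ i, a i • A i)
        = ∑ i, ∑ j, (a i * a j) • ((A i)ᵀ * A j) := by
      simp [Matrix.transpose_sum, Finset.sum_mul_sum, smul_smul, mul_comm]
    have e' : (∑ i, a i • A i)ᵀ * (∑ i, a i • A i)
        = ∑ i, ∑ j, (a i * a j) • ((A j)ᵀ * A i) := by
      rw [e, Finset.sum_comm]
      simp only [mul_comm]
    have h3 : (2 : ℝ) • ((∑ i, a i • A i)ᵀ * (∑ i, a i • A i))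
        = (2 : ℝ) • ((∑ i, (a i) ^ 2) • (1 : Matrix (Fin q) (Fin q) ℝ)) := by
      rw [two_smul]
      nth_rewrite 1 [e]
      rw [e']
      simp only [← Finset.sum_add_distrib, ← smul_add]
      rw [Finset.sum_smul, Finset.smul_sum]
      refine Finset.sum_congr rfl fun i _ => ?_
      rw [Finset.sum_eq_single i]
      · rw [h1, ← two_smul ℝ, smul_smul, smul_smul]
        congr 1
        ring
      · intro j _ hj
        rw [h2 i j hj.symm, smul_zero]
      · simp
    exact smul_right_injective _ (two_ne_zero' ℝ) h3
end

section
/- Let n = p₁ + q₁ = p₂ + q₂ with p₁ > p₂ ≥ 1, and suppose p₁ ≤ ρ(q₁) − 1 and p₂ ≤ ρ(q₂) − 1. Then p₂ ≤ ρ(p₁ − p₂) − 1. -/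
lemma hr_mono {a b : ℕ} (h : a.factorization 2 ≤ b.factorization 2) :
    hurwitzRadon a ≤ hurwitzRadon b := by
  unfold hurwitzRadon
  dsimp only
  generalize a.factorization 2 = x at *
  generalize b.factorization 2 = y at *
  split_ifs <;> omega

theorem stmt10 (n p₁ q₁ p₂ q₂ : ℕ) (h₁ : n = p₁ + q₁) (h₂ : n = p₂ + q₂)
    (hp₂ : 1 ≤ p₂) (hpp : p₂ < p₁)
    (hHR₁ : p₁ ≤ hurwitzRadon q₁ - 1) (hHR₂ : p₂ ≤ hurwitzRadon q₂ - 1) :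
    p₂ ≤ hurwitzRadon (p₁ - p₂) - 1 := by
  have key : q₁.factorization 2 ≤ (p₁ - p₂).factorization 2 ∨
      q₂.factorization 2 ≤ (p₁ - p₂).factorization 2 := by
    have hd : p₁ - p₂ = q₂ - q₁ := by omega
    have hne : p₁ - p₂ ≠ 0 := by omega
    rcases le_total (q₁.factorization 2) (q₂.factorization 2) with h | h
    · left
      rw [← Nat.prime_two.pow_dvd_iff_le_factorization hne, hd]
      exact Nat.dvd_sub ((pow_dvd_pow 2 h).trans (Nat.ordProj_dvd q₂ 2)) (Nat.ordProj_dvd q₁ 2)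
    · right
      rw [← Nat.prime_two.pow_dvd_iff_le_factorization hne, hd]
      exact Nat.dvd_sub (Nat.ordProj_dvd q₂ 2) ((pow_dvd_pow 2 h).trans (Nat.ordProj_dvd q₁ 2))
  rcases key with h | h
  · have := hr_mono h
    omega
  · have := hr_mono h
    omega
end

section
/- For every k ≥ 0, set p = ρ(2^k) − 1 and n = 2^k + ρ(2^k) − 1. Then p ≤ ρ(n − p) − 1, and for every p' with p < p' < n one has p' > ρ(n − p') − 1; that is, p is the largest value p' < n satisfying p' ≤ ρ(n − p') − 1. -/
theorem stmt11 (k p n : ℕ) (hp : p = hurwitzRadon (2 ^ k) - 1)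
    (hn : n = 2 ^ k + hurwitzRadon (2 ^ k) - 1) :
    p ≤ hurwitzRadon (n - p) - 1 ∧
      ∀ p' : ℕ, p < p' → p' < n → hurwitzRadon (n - p') - 1 < p' := by
  have hk : (2 ^ k).factorization 2 = k := by
    simp [Nat.prime_two.factorization_pow]
  have hpos : 1 ≤ hurwitzRadon (2 ^ k) := by
    simp only [hurwitzRadon, hk]
    split_ifs <;> omega
  have h2k : 0 < 2 ^ k := Nat.two_pow_pos k
  refine ⟨?_, ?_⟩
  · have : n - p = 2 ^ k := by omega
    rw [this, hp]
  · intro p' h1 h2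
    have hq0 : n - p' ≠ 0 := by omega
    have hq : n - p' < 2 ^ k := by omega
    have hv : (n - p').factorization 2 < k := by
      have h3 : 2 ^ (n - p').factorization 2 ≤ n - p' := Nat.ordProj_le 2 hq0
      exact (Nat.pow_lt_pow_iff_right (by norm_num)).1 (lt_of_le_of_lt h3 hq)
    have hmono : hurwitzRadon (n - p') ≤ hurwitzRadon (2 ^ k) := by
      simp only [hurwitzRadon, hk]
      generalize (n - p').factorization 2 = v at hv
      split_ifs <;> omega
    omega
end

section
/- Let n ≥ 8 and let p be the maximum of the set {p' : 0 ≤ p' ≤ n − 1 and p' ≤ ρ(n − p') − 1}. Then n − p is divisible by 8. -/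
theorem stmt12 (n p : ℕ) (hn : 8 ≤ n)
    (hp : IsGreatest {p' : ℕ | p' ≤ n - 1 ∧ p' ≤ hurwitzRadon (n - p') - 1} p) :
    8 ∣ n - p := by
  obtain ⟨⟨h1, h2⟩, hmax⟩ := hp
  have hr : n % 8 ≤ p := by
    apply hmax
    refine ⟨by omega, ?_⟩
    have h8 : 2 ^ 3 ∣ n - n % 8 := by omega
    have hk : 3 ≤ (n - n % 8).factorization 2 :=
      (Nat.prime_two.pow_dvd_iff_le_factorization (by omega)).1 h8
    unfold hurwitzRadon
    dsimp only
    split_ifs <;> omega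
  by_contra hnd
  have hq : n - p ≠ 0 := by omega
  have hk : (n - p).factorization 2 < 3 := by
    by_contra hk
    exact hnd ((Nat.prime_two.pow_dvd_iff_le_factorization (k := 3) hq).2 (by omega))
  have hd : 2 ^ (n - p).factorization 2 ∣ n - p := Nat.ordProj_dvd _ _
  unfold hurwitzRadon at h2
  dsimp only at h2
  generalize (n - p).factorization 2 = k at *
  interval_cases k <;> simp at h2 hd <;> omega
end

section
/- For every odd m ≥ 1 there exists k₀ such that for all k ≥ k₀, setting n = 2^k·m, there is no integer p with 1 ≤ p ≤ n − 1 and p ≤ ρ(n − p) − 1. -/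
theorem aux_four (k : ℕ) : 4 * (k + 5) + 1 < 2 ^ (k + 5) := by
  induction k with
  | zero => norm_num
  | succ j ih => rw [show j + 1 + 5 = (j + 5) + 1 by ring, pow_succ]; omega

theorem aux_lt (q : ℕ) : hurwitzRadon q - 1 < 2 ^ (q.factorization 2) := by
  unfold hurwitzRadon
  generalize q.factorization 2 = v
  by_cases hv : v < 5
  · interval_cases v <;> simp
  · obtain ⟨j, rfl⟩ : ∃ j, v = j + 5 := ⟨v - 5, by omega⟩
    have := aux_four j
    dsimp only
    split_ifs <;> omega

theorem aux_le (q : ℕ) : hurwitzRadon q - 1 ≤ 2 * (q.factorization 2) + 1 := by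
  unfold hurwitzRadon
  dsimp only
  split_ifs <;> omega

theorem stmt14 (m : ℕ) (hm : Odd m) (hm1 : 1 ≤ m) :
    ∃ k₀ : ℕ, ∀ k : ℕ, k₀ ≤ k →
      ¬ ∃ p : ℕ, 1 ≤ p ∧ p ≤ 2 ^ k * m - 1 ∧ p ≤ hurwitzRadon (2 ^ k * m - p) - 1 := by
  refine ⟨m + 10, fun k hk => ?_⟩
  rintro ⟨p, hp1, hp2, hp3⟩
  have hlt := aux_lt (2 ^ k * m - p)
  have hle := aux_le (2 ^ k * m - p)
  have hd : 2 ^ ((2 ^ k * m - p).factorization 2) ∣ 2 ^ k * m - p := Nat.ordProj_dvd _ _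
  generalize (2 ^ k * m - p).factorization 2 = v at hlt hle hd
  have hq : 0 < 2 ^ k * m - p := by
    have : 0 < 2 ^ k * m := by positivity
    omega
  have key : ∀ a, a ≤ v → a ≤ k → 2 ^ a ≤ p := by
    intro a hav hak
    have h1 : 2 ^ a ∣ 2 ^ k * m - p := (pow_dvd_pow 2 hav).trans hd
    have h2 : 2 ^ a ∣ 2 ^ k * m := Dvd.dvd.mul_right (pow_dvd_pow 2 hak) m
    have h3 : 2 ^ a ∣ p := by
      have := Nat.dvd_sub h2 h1
      rwa [Nat.sub_sub_self (by omega)] at this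
    exact Nat.le_of_dvd hp1 h3
  rcases le_total v k with h | h
  · have := key v le_rfl h
    omega
  · have h1 := key k h le_rfl
    have h2 : 2 ^ v < 2 ^ (k + m) := by
      rw [pow_add]
      calc 2 ^ v ≤ 2 ^ k * m - p := Nat.le_of_dvd hq hd
        _ ≤ 2 ^ k * m := Nat.sub_le _ _
        _ < 2 ^ k * 2 ^ m := Nat.mul_lt_mul_of_pos_left Nat.lt_two_pow_self (by positivity)
    have h3 : v < k + m := (Nat.pow_lt_pow_iff_right (by norm_num)).1 h2
    have h4 := aux_four (k - 5)
    rw [show k - 5 + 5 = k by omega] at h4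
    omega
end

section
/- Let m = 3 or m = 5 and let k ≥ 4. Then, setting n = 2^k·m, there is no integer p with 1 ≤ p ≤ n − 1 and p ≤ ρ(n − p) − 1. -/
theorem stmt15 (m k : ℕ) (hm : m = 3 ∨ m = 5) (hk : 4 ≤ k) :
    ¬ ∃ p : ℕ, 1 ≤ p ∧ p ≤ 2 ^ k * m - 1 ∧ p ≤ hurwitzRadon (2 ^ k * m - p) - 1 := by
  rintro ⟨p, hp1, hpn, hp⟩
  have hpow : ∀ j : ℕ, 4 ≤ j → 2 * j + 5 < 2 ^ j := by
    intro j hj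
    induction j, hj using Nat.le_induction with
    | base => norm_num
    | succ j hj ih => rw [pow_succ]; omega
  have h2k : 0 < 2 ^ k := by positivity
  have hlt : p < 2 ^ k * m := by omega
  have hdvd : 2 ^ ((2 ^ k * m - p).factorization 2) ∣ 2 ^ k * m - p := Nat.ordProj_dvd _ _
  unfold hurwitzRadon at hp
  simp only at hp
  generalize (2 ^ k * m - p).factorization 2 = v at hp hdvd
  -- divisibility transfers to `p` for exponents up to `k`
  have key : ∀ d, d ≤ v → d ≤ k → 2 ^ d ≤ p := by
    intro d hdv hdk
    have h1 : 2 ^ d ∣ 2 ^ k * m - p := (pow_dvd_pow 2 hdv).trans hdvd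
    have h2 : 2 ^ d ∣ 2 ^ k * m := (pow_dvd_pow 2 hdk).mul_right m
    exact Nat.le_of_dvd hp1 ((Nat.dvd_sub_iff_right hlt.le h2).1 h1)
  by_cases hvk : v ≤ k
  · have h := key v le_rfl hvk
    by_cases hv4 : 4 ≤ v
    · have := hpow v hv4
      split_ifs at hp <;> omega
    · have : v < 4 := by omega
      interval_cases v <;> norm_num at h hp <;> omega
  · have h := key k (by omega) le_rfl
    have hk5 := hpow k hk
    have hle : 2 ^ v ≤ 2 ^ k * m - p := Nat.le_of_dvd (by omega) hdvd
    have hv : v < k + 3 := by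
      by_contra hc
      have h3 : 2 ^ (k + 3) ≤ 2 ^ v := Nat.pow_le_pow_right (by norm_num) (by omega)
      rw [pow_add] at h3
      rcases hm with rfl | rfl <;> omega
    split_ifs at hp <;> omega
end

section
/- Let n ≥ 1 and suppose there is no integer p with 1 ≤ p ≤ n − 1 and p ≤ ρ(n − p) − 1. Then n ∈ {1, 2, 4, 8} or n is divisible by 16. -/
theorem hurwitzRadon_aux (j q : ℕ) (hq : q ≠ 0) (hd : 2 ^ j ∣ q) :
    ∃ k, j ≤ k ∧ hurwitzRadon q =
      if k % 4 = 0 then 2 * k + 1 else if k % 4 = 3 then 2 * k + 2 else 2 * k :=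
  ⟨q.factorization 2, (Nat.prime_two.pow_dvd_iff_le_factorization hq).1 hd, rfl⟩

theorem stmt16 (n : ℕ) (hn : 1 ≤ n)
    (h : ¬ ∃ p : ℕ, 1 ≤ p ∧ p ≤ n - 1 ∧ p ≤ hurwitzRadon (n - p) - 1) :
    n ∈ ({1, 2, 4, 8} : Set ℕ) ∨ 16 ∣ n := by
  by_contra hc
  simp only [Set.mem_insert_iff, Set.mem_singleton_iff, not_or] at hc
  obtain ⟨⟨h1, h2, h4, h8⟩, h16⟩ := hc
  apply h
  by_cases a1 : n % 2 = 1
  · obtain ⟨k, hk, e⟩ := hurwitzRadon_aux 1 (n - 1) (by omega) (by norm_num; omega)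
    refine ⟨1, by omega, by omega, ?_⟩
    rw [e]; split_ifs <;> omega
  by_cases a2 : n % 4 = 2
  · obtain ⟨k, hk, e⟩ := hurwitzRadon_aux 2 (n - 2) (by omega) (by norm_num; omega)
    refine ⟨2, by omega, by omega, ?_⟩
    rw [e]; split_ifs <;> omega
  by_cases a4 : n % 8 = 4
  · obtain ⟨k, hk, e⟩ := hurwitzRadon_aux 3 (n - 4) (by omega) (by norm_num; omega)
    refine ⟨4, by omega, by omega, ?_⟩
    rw [e]; split_ifs <;> omega
  · obtain ⟨k, hk, e⟩ := hurwitzRadon_aux 4 (n - 8) (by omega) (by norm_num; omega)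
    refine ⟨8, by omega, by omega, ?_⟩
    rw [e]; split_ifs <;> omega
end
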